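/- For any i ∈ [n−1], we have t_{i+1} t_i = (t_i − 1) t_i = t_i (t_i − 1) in k[S_n]. -/

import Mathlib

/-- The simple transposition `s_i ∈ S_n` (1-based indexing), swapping `i` and `i+1`,
defined as the identity for `i` outside `{1, …, n-1}`. -/
def simpleTransposition (n i : ℕ) : Equiv.Perm (Fin n) :=
  if h : 1 ≤ i ∧ i < n then
    Equiv.swap ⟨i - 1, by omega⟩ ⟨i, h.2⟩
  else 1

/-- The cycle `(v ⟹ w) = s_v s_{v+1} ⋯ s_{w-1} ∈ S_n`, sending
`v ↦ v+1 ↦ ⋯ ↦ w ↦ v` (and equal to the identity when `v = w`). -/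
def cyc (n v w : ℕ) : Equiv.Perm (Fin n) :=
  ((List.range' v (w - v)).map (simpleTransposition n)).prod

/-- The somewhere-to-below shuffle `t_ℓ = Σ_{w=ℓ}^{n} (ℓ ⟹ w)` in the group
algebra `R[S_n]`. -/
noncomputable def t (R : Type*) [CommRing R] (n ℓ : ℕ) :
    MonoidAlgebra R (Equiv.Perm (Fin n)) :=
  ∑ w ∈ Finset.Icc ℓ n, MonoidAlgebra.of R (Equiv.Perm (Fin n)) (cyc n ℓ w)

theorem simpleTransposition_mul_self (n i : ℕ) :
    simpleTransposition n i * simpleTransposition n i = 1 := by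
  unfold simpleTransposition
  split_ifs <;> simp

theorem simpleTransposition_commute (n : ℕ) {i j : ℕ} (h : i + 1 < j) :
    Commute (simpleTransposition n i) (simpleTransposition n j) := by
  unfold simpleTransposition
  split_ifs with hi hj
  · apply Equiv.Perm.Disjoint.commute
    intro x
    simp only [Equiv.swap_apply_def, Fin.ext_iff]
    grind
  · exact Commute.one_right _
  · exact Commute.one_left _
  · exact Commute.one_left _

theorem simpleTransposition_braid {n j : ℕ} (hj : 1 ≤ j) (hjn : j + 1 < n) :
    simpleTransposition n j * simpleTransposition n (j + 1) * simpleTransposition n j =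
      simpleTransposition n (j + 1) * simpleTransposition n j *
        simpleTransposition n (j + 1) := by
  unfold simpleTransposition
  rw [dif_pos ⟨hj, by omega⟩, dif_pos ⟨by omega, hjn⟩]
  ext x
  simp only [Equiv.Perm.mul_apply, Equiv.swap_apply_def, Fin.ext_iff]
  grind

theorem cyc_self (n v : ℕ) : cyc n v v = 1 := by simp [cyc]

theorem cyc_succ_right (n : ℕ) {v w : ℕ} (h : v ≤ w) :
    cyc n v (w + 1) = cyc n v w * simpleTransposition n w := by
  simp [cyc, Nat.sub_add_comm h, List.range'_1_concat, h]

theorem cyc_eq_mul_cyc_succ_left (n : ℕ) {v w : ℕ} (h : v < w) :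
    cyc n v w = simpleTransposition n v * cyc n (v + 1) w := by
  obtain ⟨d, rfl⟩ := Nat.exists_eq_add_of_lt h
  simp [cyc, show v + d + 1 - v = d + 1 by omega, show v + d + 1 - (v + 1) = d by omega,
    List.range'_succ]

theorem cyc_commute_simpleTransposition (n : ℕ) {v w j : ℕ} (h : w < j) :
    Commute (cyc n v w) (simpleTransposition n j) := by
  apply Commute.list_prod_left
  intro x hx
  obtain ⟨l, hl, rfl⟩ := List.mem_map.mp hx
  rw [List.mem_range'_1] at hl
  exact simpleTransposition_commute n (by omega)

theorem cyc_mul_simpleTransposition {n v u j : ℕ} (hv : 1 ≤ v) (hvj : v ≤ j) (hju : j + 1 < u)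
    (hun : u ≤ n) :
    cyc n v u * simpleTransposition n j = simpleTransposition n (j + 1) * cyc n v u := by
  induction u, (show j + 2 ≤ u from hju) using Nat.le_induction with
  | base =>
    rw [cyc_succ_right n (by omega : v ≤ j + 1), cyc_succ_right n hvj]
    have hb := simpleTransposition_braid (n := n) (hv.trans hvj) (by omega)
    calc _ = cyc n v j * (simpleTransposition n j * simpleTransposition n (j + 1) *
              simpleTransposition n j) := by simp only [mul_assoc]
      _ = (cyc n v j * simpleTransposition n (j + 1)) * (simpleTransposition n j *
              simpleTransposition n (j + 1)) := by rw [hb]; simp only [mul_assoc]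
      _ = _ := by
        rw [(cyc_commute_simpleTransposition n (Nat.lt_succ_self j)).eq]
        simp only [mul_assoc]
  | succ u hu ih =>
    rw [cyc_succ_right n (by omega : v ≤ u), mul_assoc,
      ← (simpleTransposition_commute n (show j + 1 < u by omega)).eq, ← mul_assoc,
      ih (by omega) (by omega), mul_assoc]

theorem cyc_mul_cyc {n v a b : ℕ} (hv : 1 ≤ v) (hvb : v ≤ b) (hba : b < a) (han : a ≤ n) :
    cyc n v a * cyc n v b = cyc n (v + 1) (b + 1) * cyc n v a := by
  induction b, hvb using Nat.le_induction with
  | base => simp [cyc_self]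
  | succ b hb ih =>
    rw [cyc_succ_right n hb, ← mul_assoc, ih (by omega), mul_assoc,
      cyc_mul_simpleTransposition hv hb hba han, ← mul_assoc, ← cyc_succ_right n (by omega)]

theorem cyc_succ_mul_cyc {n v a b : ℕ} (hv : 1 ≤ v) (hvb : v ≤ b) (hba : b < a) (han : a ≤ n) :
    cyc n (v + 1) a * cyc n v b = cyc n v (b + 1) * cyc n v a := by
  apply mul_left_cancel (a := simpleTransposition n v)
  rw [← mul_assoc, ← cyc_eq_mul_cyc_succ_left n (by omega), cyc_mul_cyc hv hvb hba han,
    cyc_eq_mul_cyc_succ_left n (by omega : v < b + 1), ← mul_assoc, ← mul_assoc,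
    simpleTransposition_mul_self, one_mul]

theorem t_eq_one_add (R : Type*) [CommRing R] {n i : ℕ} (h : i ≤ n) :
    t R n i = 1 + MonoidAlgebra.of R _ (simpleTransposition n i) * t R n (i + 1) := by
  unfold t
  rw [← Finset.insert_Icc_succ_left_eq_Icc h, Finset.sum_insert (by simp), cyc_self, map_one,
    Finset.mul_sum]
  congr 1
  refine Finset.sum_congr rfl fun w hw => ?_
  rw [← map_mul, ← cyc_eq_mul_cyc_succ_left n (by simpa using (Finset.mem_Icc.mp hw).1)]

theorem simpleTransposition_mul_t_succ_mul_t (R : Type*) [CommRing R] {n i : ℕ} (hi : 1 ≤ i) :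
    MonoidAlgebra.of R _ (simpleTransposition n i) * (t R n (i + 1) * t R n i) =
      t R n (i + 1) * t R n i := by
  unfold t
  rw [Finset.sum_mul_sum, ← Finset.sum_product', Finset.mul_sum]
  let f : ℕ × ℕ → ℕ × ℕ := fun p => if p.2 < p.1 then (p.2 + 1, p.1) else (p.2, p.1 - 1)
  have hmem : ∀ p ∈ Finset.Icc (i + 1) n ×ˢ Finset.Icc i n,
      f p ∈ Finset.Icc (i + 1) n ×ˢ Finset.Icc i n := by
    rintro ⟨u, w⟩ h
    simp only [Finset.mem_product, Finset.mem_Icc] at h ⊢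
    grind
  have hinv : ∀ p ∈ Finset.Icc (i + 1) n ×ˢ Finset.Icc i n, f (f p) = p := by
    rintro ⟨u, w⟩ h
    simp only [Finset.mem_product, Finset.mem_Icc] at h
    grind
  refine Finset.sum_nbij' f f hmem hmem hinv hinv ?_
  rintro ⟨u, w⟩ h
  simp only [Finset.mem_product, Finset.mem_Icc] at h
  simp only [f, ← map_mul]
  rw [← mul_assoc, ← cyc_eq_mul_cyc_succ_left n (by omega)]
  split_ifs with hwu
  · rw [cyc_mul_cyc hi h.2.1 hwu h.1.2]
  · rw [cyc_succ_mul_cyc hi (by omega) (by omega) h.2.2, Nat.sub_add_cancel (by omega)]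

theorem ti_succ_mul_ti
    (R : Type*) [CommRing R] (n : ℕ) (hn : 0 < n)
    (i : ℕ) (hi1 : 1 ≤ i) (hin : i ≤ n - 1) :
    t R n (i + 1) * t R n i = (t R n i - 1) * t R n i ∧
    (t R n i - 1) * t R n i = t R n i * (t R n i - 1) := by
  refine ⟨?_, by rw [sub_mul, mul_sub, one_mul, mul_one]⟩
  have h : t R n i - 1 = MonoidAlgebra.of R _ (simpleTransposition n i) * t R n (i + 1) :=
    sub_eq_of_eq_add' (t_eq_one_add R (by omega))
  rw [h, mul_assoc, simpleTransposition_mul_t_succ_mul_t R hi1]
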